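/- arXiv:1811.06205 — 2 statements merged into one kernel-verified Lean document; each statement's English description precedes it below -/
import Mathlib

section
/- Let G be a finite pseudoreflection subgroup of GL(n,ℂ) and let θ₁,…,θₙ be a homogeneous system of parameters for G, with θ : ℂⁿ → ℂⁿ the associated polynomial map. Then: (i) θ is surjective onto ℂⁿ; (ii) for all z, w ∈ ℂⁿ, θ(z) = θ(w) if and only if w = σz for some σ ∈ G. Consequently θ induces a bijection from the orbit space ℂⁿ/G onto ℂⁿ. -/
open MvPolynomial

noncomputable section

/-- The natural action of an invertible matrix on `ℂⁿ` by matrix-vector multiplication. -/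
def gAct {n : ℕ} (σ : GL (Fin n) ℂ) (z : Fin n → ℂ) : Fin n → ℂ :=
  Matrix.mulVec (σ : Matrix (Fin n) (Fin n) ℂ) z

/-- A pseudoreflection: an element of finite order in `GL(n,ℂ)` with `rank (1 - ρ) = 1`. -/
def IsPseudoreflection {n : ℕ} (ρ : GL (Fin n) ℂ) : Prop :=
  IsOfFinOrder ρ ∧ Matrix.rank ((1 : Matrix (Fin n) (Fin n) ℂ) - (ρ : Matrix (Fin n) (Fin n) ℂ)) = 1

/-- A subgroup of `GL(n,ℂ)` is a pseudoreflection group if it is generated by the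
pseudoreflections it contains. -/
def IsPseudoreflectionGroup {n : ℕ} (G : Subgroup (GL (Fin n) ℂ)) : Prop :=
  Subgroup.closure {ρ : GL (Fin n) ℂ | ρ ∈ G ∧ IsPseudoreflection ρ} = G

/-- The action of `σ ∈ GL(n,ℂ)` on polynomials: `(σ·p)(z) = p(σ⁻¹z)`. -/
def polyAct {n : ℕ} (σ : GL (Fin n) ℂ) (p : MvPolynomial (Fin n) ℂ) : MvPolynomial (Fin n) ℂ :=
  MvPolynomial.aeval
    (fun i => ∑ j, MvPolynomial.C (((σ⁻¹ : GL (Fin n) ℂ) : Matrix (Fin n) (Fin n) ℂ) i j)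
      * MvPolynomial.X j) p

/-- The polynomial map `θ : ℂⁿ → ℂⁿ` associated to a tuple of polynomials. -/
def polyMap {n : ℕ} (θ : Fin n → MvPolynomial (Fin n) ℂ) (z : Fin n → ℂ) : Fin n → ℂ :=
  fun i => MvPolynomial.eval z (θ i)

theorem gAct_one {n : ℕ} (z : Fin n → ℂ) : gAct 1 z = z := by
  simp [gAct]

theorem gAct_mul {n : ℕ} (σ τ : GL (Fin n) ℂ) (z : Fin n → ℂ) :
    gAct (σ * τ) z = gAct σ (gAct τ z) := by
  simp [gAct, Matrix.mulVec_mulVec]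

theorem eval_polyAct {n : ℕ} (σ : GL (Fin n) ℂ) (p : MvPolynomial (Fin n) ℂ) (z : Fin n → ℂ) :
    eval z (polyAct σ p) = eval (gAct σ⁻¹ z) p := by
  have hz : (fun i => aeval z (∑ j, C (((σ⁻¹ : GL (Fin n) ℂ) : Matrix (Fin n) (Fin n) ℂ) i j) *
      X j)) = gAct σ⁻¹ z := by
    funext i
    simp only [map_sum, map_mul, aeval_C, aeval_X]
    rfl
  rw [← coe_aeval_eq_eval, ← coe_aeval_eq_eval, RingHom.coe_coe, RingHom.coe_coe, polyAct,
    comp_aeval_apply, hz]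

theorem polyAct_one {n : ℕ} (p : MvPolynomial (Fin n) ℂ) : polyAct 1 p = p :=
  MvPolynomial.funext fun z => by rw [eval_polyAct, inv_one, gAct_one]

theorem polyAct_mul {n : ℕ} (σ τ : GL (Fin n) ℂ) (p : MvPolynomial (Fin n) ℂ) :
    polyAct (σ * τ) p = polyAct σ (polyAct τ p) :=
  MvPolynomial.funext fun z => by
    rw [eval_polyAct, eval_polyAct, eval_polyAct, mul_inv_rev, gAct_mul]

/-- The action of a subgroup of `GL(n,ℂ)` on polynomials by ring automorphisms. -/
@[reducible]
def polyMulSemiringAction {n : ℕ} (G : Subgroup (GL (Fin n) ℂ)) :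
    MulSemiringAction G (MvPolynomial (Fin n) ℂ) where
  smul σ p := polyAct (σ : GL (Fin n) ℂ) p
  one_smul := polyAct_one
  mul_smul σ τ := polyAct_mul (σ : GL (Fin n) ℂ) τ
  smul_zero _ := by simp only [HSMul.hSMul, polyAct, map_zero]
  smul_add _ _ _ := by simp only [HSMul.hSMul, polyAct, map_add]
  smul_one _ := by simp only [HSMul.hSMul, polyAct, map_one]
  smul_mul _ _ _ := by simp only [HSMul.hSMul, polyAct, map_mul]

/-- Polynomials are integral over any subalgebra that contains all invariants of a finite group
and only invariants. -/
theorem isIntegral_of_mem_iff_invariant {n : ℕ} (G : Subgroup (GL (Fin n) ℂ)) [Finite G]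
    (S : Subalgebra ℂ (MvPolynomial (Fin n) ℂ))
    (hS : ∀ p : MvPolynomial (Fin n) ℂ, (∀ σ ∈ G, polyAct σ p = p) ↔ p ∈ S) :
    Algebra.IsIntegral S (MvPolynomial (Fin n) ℂ) := by
  let _ := polyMulSemiringAction G
  have : Algebra.IsInvariant S (MvPolynomial (Fin n) ℂ) G :=
    ⟨fun p hp => ⟨⟨p, (hS p).1 fun σ hσ => hp ⟨σ, hσ⟩⟩, rfl⟩⟩
  exact Algebra.IsInvariant.isIntegral S (MvPolynomial (Fin n) ℂ) G

/-- If polynomials are integral over the algebra generated by an algebraically independent tuple,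
then the associated polynomial map is surjective. -/
theorem polyMap_surjective_of_isIntegral {n : ℕ} (θ : Fin n → MvPolynomial (Fin n) ℂ)
    (hθ : AlgebraicIndependent ℂ θ)
    [Algebra.IsIntegral (Algebra.adjoin ℂ (Set.range θ)) (MvPolynomial (Fin n) ℂ)] :
    Function.Surjective (polyMap θ) := by
  intro c
  let φ : Algebra.adjoin ℂ (Set.range θ) →ₐ[ℂ] ℂ := (aeval c).comp hθ.repr
  have hφ : Function.Surjective φ := fun a => ⟨algebraMap ℂ _ a, φ.commutes a⟩
  have : (RingHom.ker φ).IsMaximal := RingHom.ker_isMaximal_of_surjective φ hφ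
  obtain ⟨M, hM, hMφ⟩ := Ideal.exists_ideal_over_maximal_of_isIntegral
    (S := MvPolynomial (Fin n) ℂ) (RingHom.ker φ) (by
      rw [(RingHom.injective_iff_ker_eq_bot _).1 Subtype.val_injective]
      exact bot_le)
  obtain ⟨z, rfl⟩ := (isMaximal_iff_eq_vanishingIdeal_singleton (I := M)).1 hM
  refine ⟨z, _root_.funext fun i => ?_⟩
  have hmem : θ i ∈ Algebra.adjoin ℂ (Set.range θ) := Algebra.subset_adjoin ⟨i, rfl⟩
  have hval : hθ.repr ⟨θ i, hmem⟩ = X i := hθ (by rw [hθ.aeval_repr, aeval_X])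
  have hker : (⟨θ i, hmem⟩ - algebraMap ℂ _ (c i) : Algebra.adjoin ℂ (Set.range θ)) ∈
      RingHom.ker φ := by
    simp [RingHom.mem_ker, φ, hval]
  rw [← hMφ, Ideal.mem_comap, mem_vanishingIdeal_singleton_iff, map_sub, map_sub,
    sub_eq_zero] at hker
  simpa [polyMap, aeval_eq_eval, ← IsScalarTower.algebraMap_apply] using hker

/-- A point can be separated from a finite family of other points by a polynomial. -/
theorem exists_eval_eq_zero_and_eval_eq_one {ι κ K : Type*} [Fintype κ] [Field K]
    (w : ι → K) (u : κ → ι → K) (h : ∀ k, u k ≠ w) :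
    ∃ p : MvPolynomial ι K, eval w p = 0 ∧ ∀ k, eval (u k) p = 1 := by
  choose i hi using fun k => Function.ne_iff.1 (h k)
  refine ⟨1 - ∏ k, C (w (i k) - u k (i k))⁻¹ * (X (i k) - C (u k (i k))), ?_, fun k => ?_⟩
  · have : ∏ k, (w (i k) - u k (i k))⁻¹ * (w (i k) - u k (i k)) = 1 :=
      Finset.prod_eq_one fun k _ => inv_mul_cancel₀ (sub_ne_zero.2 (hi k).symm)
    simp only [map_sub, map_one, map_prod, map_mul, eval_C, eval_X, this, sub_self]
  · rw [map_sub, map_one, map_prod, Finset.prod_eq_zero (Finset.mem_univ k) (by simp), sub_zero]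

/-- Invariant polynomials of a finite group separate orbits. -/
theorem exists_gAct_eq_of_eval_invariant_eq {n : ℕ} (G : Subgroup (GL (Fin n) ℂ)) [Finite G]
    (z w : Fin n → ℂ)
    (h : ∀ p : MvPolynomial (Fin n) ℂ, (∀ σ ∈ G, polyAct σ p = p) → eval z p = eval w p) :
    ∃ σ ∈ G, w = gAct σ z := by
  by_contra! hne
  cases nonempty_fintype G
  let _ := polyMulSemiringAction G
  obtain ⟨p, hpw, hpz⟩ := exists_eval_eq_zero_and_eval_eq_one w
    (fun σ : G => gAct (σ : GL (Fin n) ℂ) z) fun σ => (hne σ σ.2).symm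
  have heval (σ : G) (x : Fin n → ℂ) : eval x (σ • p) = eval (gAct ((σ⁻¹ : G) : GL _ ℂ) x) p :=
    eval_polyAct _ _ _
  have hinv := h (∏ σ : G, σ • p) fun τ hτ => by
    change (⟨τ, hτ⟩ : G) • (∏ σ : G, σ • p) = _
    rw [Finset.smul_prod']
    simp only [smul_smul]
    exact (Group.mulLeft_bijective (⟨τ, hτ⟩ : G)).prod_comp fun σ => σ • p
  rw [map_prod, map_prod, Finset.prod_eq_one fun σ _ => (heval σ z).trans (hpz σ⁻¹),
    Finset.prod_eq_zero (Finset.mem_univ 1) (by rw [one_smul, hpw])] at hinv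
  exact one_ne_zero hinv

/-- The basic polynomial map `θ` of a finite pseudoreflection group `G` is surjective onto
`ℂⁿ`, and its fibers are exactly the `G`-orbits; consequently `θ` induces a bijection
`ℂⁿ/G → ℂⁿ`. -/
theorem theta_surjective_fibers_orbits {n : ℕ} (G : Subgroup (GL (Fin n) ℂ)) [Finite G]
    (hG : IsPseudoreflectionGroup G)
    (θ : Fin n → MvPolynomial (Fin n) ℂ) (dd : Fin n → ℕ)
    (hθhom : ∀ i, (θ i).IsHomogeneous (dd i))
    (hθalg : AlgebraicIndependent ℂ θ)
    (hθgen : ∀ p : MvPolynomial (Fin n) ℂ,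
      (∀ σ ∈ G, polyAct σ p = p) ↔ p ∈ Algebra.adjoin ℂ (Set.range θ)) :
    Function.Surjective (polyMap θ) ∧
      ∀ z w : Fin n → ℂ, polyMap θ z = polyMap θ w ↔ ∃ σ ∈ G, w = gAct σ z := by
  have := isIntegral_of_mem_iff_invariant G _ hθgen
  refine ⟨polyMap_surjective_of_isIntegral θ hθalg, fun z w => ⟨fun hzw => ?_, ?_⟩⟩
  · refine exists_gAct_eq_of_eval_invariant_eq G z w fun p hp => ?_
    have hle : Algebra.adjoin ℂ (Set.range θ) ≤
        AlgHom.equalizer (aeval z : MvPolynomial (Fin n) ℂ →ₐ[ℂ] ℂ) (aeval w) := by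
      rw [Algebra.adjoin_le_iff]
      rintro _ ⟨i, rfl⟩
      exact congrFun hzw i
    exact hle ((hθgen p).1 hp)
  · rintro ⟨σ, hσ, rfl⟩
    funext i
    have hi := (hθgen (θ i)).2 (Algebra.subset_adjoin ⟨i, rfl⟩) σ⁻¹ (inv_mem hσ)
    change eval z (θ i) = eval (gAct σ z) (θ i)
    conv_lhs => rw [← hi]
    rw [eval_polyAct, inv_inv]
end
end

section
/- Let G be a finite pseudoreflection subgroup of GL(n,ℂ), d = |G|, let p₁,…,p_d be a basis of ℂ[z] as a module over ℂ[z]^G, and let Λ be the d×d matrix over ℂ[z] with (i,j)-entry ρᵢ·p_j, where G = {ρ₁,…,ρ_d}. Then det Λ is not the zero polynomial. -/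
open MvPolynomial

noncomputable section

/-- `polyAct σ` as an algebra homomorphism. -/
def polyActHom {n : ℕ} (σ : GL (Fin n) ℂ) :
    MvPolynomial (Fin n) ℂ →ₐ[ℂ] MvPolynomial (Fin n) ℂ :=
  MvPolynomial.aeval
    (fun i => ∑ j, MvPolynomial.C (((σ⁻¹ : GL (Fin n) ℂ) : Matrix (Fin n) (Fin n) ℂ) i j)
      * MvPolynomial.X j)

theorem coeff_polyActHom_X {n : ℕ} (σ : GL (Fin n) ℂ) (i k : Fin n) :
    coeff (Finsupp.single k 1) (polyActHom σ (X i)) =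
      ((σ⁻¹ : GL (Fin n) ℂ) : Matrix (Fin n) (Fin n) ℂ) i k := by
  classical
  simp [polyActHom, coeff_sum, coeff_C_mul, coeff_X, Finsupp.single_left_inj]

/-- The action of `GL(n,ℂ)` on polynomials is faithful. -/
theorem polyActHom_injective {n : ℕ} :
    Function.Injective (polyActHom : GL (Fin n) ℂ → _) := by
  intro σ τ h
  apply inv_injective
  ext i k
  rw [← coeff_polyActHom_X, ← coeff_polyActHom_X, h]

/-- Dedekind independence: distinct elements of `GL(n,ℂ)` act on polynomials by linearly
independent maps. -/
theorem linearIndependent_polyActHom {n : ℕ} :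
    LinearIndependent (MvPolynomial (Fin n) ℂ)
      (fun (σ : GL (Fin n) ℂ) (q : MvPolynomial (Fin n) ℂ) => polyActHom σ q) := by
  refine (linearIndependent_monoidHom (MvPolynomial (Fin n) ℂ) (MvPolynomial (Fin n) ℂ)).comp
    (fun σ : GL (Fin n) ℂ => (polyActHom σ : MvPolynomial (Fin n) ℂ →* MvPolynomial (Fin n) ℂ)) ?_
  intro σ τ h
  exact polyActHom_injective (AlgHom.ext fun q => DFunLike.congr_fun h q)

/-- For a finite pseudoreflection group `G = {ρ₁,…,ρ_d}` and a basis `p₁,…,p_d` of `ℂ[z]`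
over `ℂ[z]^G`, the determinant of the matrix `Λ = ((ρᵢ·p_j))` is not the zero polynomial. -/
theorem det_Lambda_ne_zero {n : ℕ} (G : Subgroup (GL (Fin n) ℂ)) [Finite G]
    (hG : IsPseudoreflectionGroup G) (d : ℕ) (e : Fin d ≃ G)
    (p : Fin d → MvPolynomial (Fin n) ℂ)
    (hbasis_ex : ∀ q : MvPolynomial (Fin n) ℂ, ∃ r : Fin d → MvPolynomial (Fin n) ℂ,
      (∀ i, ∀ σ ∈ G, polyAct σ (r i) = r i) ∧ q = ∑ i, r i * p i)
    (hbasis_uniq : ∀ r r' : Fin d → MvPolynomial (Fin n) ℂ,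
      (∀ i, ∀ σ ∈ G, polyAct σ (r i) = r i) → (∀ i, ∀ σ ∈ G, polyAct σ (r' i) = r' i) →
      ∑ i, r i * p i = ∑ i, r' i * p i → r = r') :
    Matrix.det (Matrix.of fun i j : Fin d => polyAct (↑(e i) : GL (Fin n) ℂ) (p j)) ≠ 0 := by
  intro hdet
  obtain ⟨v, hv, hvΛ⟩ := Matrix.exists_vecMul_eq_zero_iff.mpr hdet
  apply hv
  have hli := linearIndependent_polyActHom.comp (fun i : Fin d => (e i : GL (Fin n) ℂ))
    (Subtype.val_injective.comp e.injective)
  refine funext (Fintype.linearIndependent_iff.mp hli v (funext fun q => ?_))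
  obtain ⟨r, hr, rfl⟩ := hbasis_ex q
  have hcol (j : Fin d) : ∑ i, v i * polyActHom (e i : GL (Fin n) ℂ) (p j) = 0 :=
    congrFun hvΛ j
  have hinv (i j : Fin d) : polyActHom (e i : GL (Fin n) ℂ) (r j) = r j := hr j _ (e i).2
  simp only [Finset.sum_apply, Pi.smul_apply, Function.comp_apply, smul_eq_mul, map_sum,
    map_mul, hinv, Finset.mul_sum, Pi.zero_apply]
  rw [Finset.sum_comm]
  refine Finset.sum_eq_zero fun j _ => ?_
  simp only [mul_left_comm _ (r j), ← Finset.mul_sum, hcol, mul_zero]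
end
end
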